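/- If α < α_th, then C_{h,σ²}(A, αA) ≥ (1/2)·log(1 + (A² s_n² / (2π e σ²))·e^{2ν}), where ν = sup over λ ∈ (max{0, 1/2 + α − α_th}, min{1/2, α}) of { 1 − log( μ(λ)/(1 − e^{−μ(λ)}) ) − μ(λ) e^{−μ(λ)}/(1 − e^{−μ(λ)}) − ∑_{k=1}^n p_k log( p_k s_n / h_k ) }, where p_k = h_k a^k / ∑_{j=1}^n h_j a^j with a the unique positive solution of ( ∑_{k=1}^n h_k k a^k ) / ( ∑_{j=1}^n h_j a^j ) = α − λ + 1. -/

import Mathlib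

open MeasureTheory ProbabilityTheory Real Filter
open scoped NNReal ENNReal Classical

noncomputable section

/-- Kullback–Leibler divergence (Mathlib's `ProbabilityTheory.klDiv`). -/
def klDiv {α : Type*} [MeasurableSpace α] (μ ν : Measure α) : EReal :=
  if μ ≪ ν ∧ Integrable (llr μ ν) μ then ((∫ x, llr μ ν x ∂μ : ℝ) : EReal) else ⊤

/-- Mutual information of a joint law: KL divergence of the joint law from the
product of its marginals. -/
def mutualInfo {α β : Type*} [MeasurableSpace α] [MeasurableSpace β]
    (joint : Measure (α × β)) : EReal :=
  klDiv joint ((joint.map Prod.fst).prod (joint.map Prod.snd))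

/-- Partial sums `s_k = h_1 + ⋯ + h_k`. -/
def sCum {n : ℕ} (h : Fin n → ℝ) (k : ℕ) : ℝ :=
  ∑ i : Fin n, if i.val < k then h i else 0

/-- Joint law of `(X, Y)` with `Y = hᵀX + Z`, `Z ~ N(0, v)` independent of `X`. -/
def misoJoint {n : ℕ} (h : Fin n → ℝ) (v : ℝ≥0) (μ : Measure (Fin n → ℝ)) :
    Measure ((Fin n → ℝ) × ℝ) :=
  (μ.prod (gaussianReal 0 v)).map (fun p => (p.1, (∑ k, h k * p.1 k) + p.2))

/-- MISO capacity under peak-power constraint `A` and average-power constraint `E`. -/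
def misoCapacity {n : ℕ} (h : Fin n → ℝ) (v : ℝ≥0) (A E : ℝ) : EReal :=
  ⨆ μ ∈ {μ : Measure (Fin n → ℝ) | IsProbabilityMeasure μ ∧
      (∀ k, ∀ᵐ x ∂μ, x k ∈ Set.Icc 0 A) ∧ (∑ k, ∫ x, x k ∂μ) ≤ E},
    mutualInfo (misoJoint h v μ)

/-- MISO capacity under only an average-power constraint `E`. -/
def misoCapacityAvg {n : ℕ} (h : Fin n → ℝ) (v : ℝ≥0) (E : ℝ) : EReal :=
  ⨆ μ ∈ {μ : Measure (Fin n → ℝ) | IsProbabilityMeasure μ ∧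
      (∀ k, ∀ᵐ x ∂μ, 0 ≤ x k) ∧ (∑ k, ∫ x, x k ∂μ) ≤ E},
    mutualInfo (misoJoint h v μ)

/-- Joint law of `(X̄, X̄ + Z)` for the unit-gain SISO channel. -/
def sisoJoint (v : ℝ≥0) (μ : Measure ℝ) : Measure (ℝ × ℝ) :=
  (μ.prod (gaussianReal 0 v)).map (fun p => (p.1, p.1 + p.2))

/-- Unit-gain SISO capacity under peak-power constraint `A` and average-power
constraint `E`. -/
def sisoCapacity (v : ℝ≥0) (A E : ℝ) : EReal :=
  ⨆ μ ∈ {μ : Measure ℝ | IsProbabilityMeasure μ ∧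
      (∀ᵐ x ∂μ, x ∈ Set.Icc 0 A) ∧ (∫ x, x ∂μ) ≤ E},
    mutualInfo (sisoJoint v μ)

/-- Unit-gain SISO capacity under only an average-power constraint `E`. -/
def sisoCapacityAvg (v : ℝ≥0) (E : ℝ) : EReal :=
  ⨆ μ ∈ {μ : Measure ℝ | IsProbabilityMeasure μ ∧
      (∀ᵐ x ∂μ, 0 ≤ x) ∧ (∫ x, x ∂μ) ≤ E},
    mutualInfo (sisoJoint v μ)

/-- The interval `(s_{k-1} A, s_k A]` (with the first one being `[0, s_1 A]`)
corresponding to the event `U = k` (0-indexed: `k ∈ Fin n` stands for `k+1`). -/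
def uInterval {n : ℕ} (h : Fin n → ℝ) (A : ℝ) (k : Fin n) : Set ℝ :=
  if k.val = 0 then Set.Icc 0 (sCum h 1 * A)
  else Set.Ioc (sCum h k.val * A) (sCum h (k.val + 1) * A)

/-- The average input power `∑_k p_k ((E[X̄ | U=k] - A s_{k-1})/h_k + (k-1) A)`
consumed to generate a scalar law of `X̄`. -/
def avgPowerUse {n : ℕ} (h : Fin n → ℝ) (A : ℝ) (μ : Measure ℝ) : ℝ :=
  ∑ k : Fin n,
    (((∫ x in uInterval h A k, x ∂μ) - A * sCum h k.val * (μ (uInterval h A k)).toReal) / h k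
      + (k.val : ℝ) * A * (μ (uInterval h A k)).toReal)

/-- The threshold `α_th`. -/
def alphaTh {n : ℕ} (h : Fin n → ℝ) : ℝ :=
  1 / 2 + (1 / sCum h n) * ∑ k : Fin n, h k * (k.val : ℝ)

end

/-- Change of variables behind the entropy power inequality: after rotating a pair of independent
standard Gaussians, `T g + σ z` is monotone in one coordinate with the other one frozen. -/
lemma lintegral_gaussian_rotation_le_one {T : ℝ → ℝ} (hT : Monotone T) {K : Set ℝ}
    (hK : K.Countable) (hd : ∀ g ∉ K, DifferentiableAt ℝ T g) {q : ℝ → ℝ≥0∞} (hq : Measurable q)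
    (hq1 : ∫⁻ y, q y ≤ 1) {σ θ : ℝ} (hσ : 0 ≤ σ) (hc : 0 < cos θ) (hs : 0 ≤ sin θ) :
    ∫⁻ x : ℝ × ℝ, q (T x.1 + σ * x.2) * ENNReal.ofReal (cos θ * deriv T x.1 + sin θ * σ)
        / gaussianPDF 0 1 (cos θ * x.1 + sin θ * x.2)
      ∂((gaussianReal 0 1).prod (gaussianReal 0 1)) ≤ 1 := by
  set F : ℝ × ℝ → ℝ≥0∞ := fun x => q (T x.1 + σ * x.2) *
    ENNReal.ofReal (cos θ * deriv T x.1 + sin θ * σ)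
      / gaussianPDF 0 1 (cos θ * x.1 + sin θ * x.2) with hF
  have hTm : Measurable T := hT.measurable
  have hdm : Measurable (deriv T) := measurable_deriv T
  have hφ := measurable_gaussianPDF 0 1
  have hFm : Measurable F := by
    have := hq.comp (f := fun x : ℝ × ℝ => T x.1 + σ * x.2) (by fun_prop)
    have h2 := hφ.comp (f := fun x : ℝ × ℝ => cos θ * x.1 + sin θ * x.2) (by fun_prop)
    exact (this.mul (by fun_prop)).div h2
  have hrot := IsGaussian.map_rotation_eq_self (μ := gaussianReal 0 1) (by simp) (-θ)
  rw [← hrot, lintegral_map hFm (by fun_prop)]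
  have hFR := hFm.comp (ContinuousLinearMap.rotation (E := ℝ) (-θ)).measurable
  rw [lintegral_prod_symm _ (by exact hFR.aemeasurable)]
  have key : ∀ w, ∫⁻ u, F (ContinuousLinearMap.rotation (-θ) (u, w)) ∂(gaussianReal 0 1) ≤ 1 := by
    intro w
    rw [gaussianReal_of_var_ne_zero _ one_ne_zero,
      lintegral_withDensity_eq_lintegral_mul _ hφ
        (by exact hFR.comp (measurable_id.prodMk measurable_const))]
    set Θ : ℝ → ℝ := fun u => T (cos θ * u - sin θ * w) + σ * (sin θ * u + cos θ * w) with hΘ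
    set Θ' : ℝ → ℝ := fun u => cos θ * deriv T (cos θ * u - sin θ * w) + sin θ * σ with hΘ'
    set S : Set ℝ := ((fun u => cos θ * u - sin θ * w) ⁻¹' K)ᶜ with hS
    have hinj : Function.Injective (fun u => cos θ * u - sin θ * w) := by
      intro x y hxy
      have : cos θ * x = cos θ * y := by simpa using hxy
      exact mul_left_cancel₀ hc.ne' this
    have hSc : Sᶜ.Countable := by
      rw [hS, compl_compl]
      exact hK.preimage_of_injOn hinj.injOn
    have hSm : MeasurableSet S := hSc.measurableSet.of_compl
    have hmono : Monotone Θ := by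
      intro x y hxy
      have h1 : cos θ * x - sin θ * w ≤ cos θ * y - sin θ * w := by gcongr
      have h2 := hT h1
      have h3 : σ * (sin θ * x + cos θ * w) ≤ σ * (sin θ * y + cos θ * w) := by gcongr
      exact add_le_add h2 h3
    have hder : ∀ u ∈ S, HasDerivWithinAt Θ (Θ' u) S u := by
      intro u hu
      have h1 : HasDerivAt T (deriv T (cos θ * u - sin θ * w)) (cos θ * u - sin θ * w) :=
        (hd _ hu).hasDerivAt
      have h2 : HasDerivAt (fun u => cos θ * u - sin θ * w) (cos θ) u := by
        simpa using ((hasDerivAt_id u).const_mul (cos θ)).sub_const (sin θ * w)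
      have h3 : HasDerivAt (fun u => σ * (sin θ * u + cos θ * w)) (σ * sin θ) u := by
        simpa using (((hasDerivAt_id u).const_mul (sin θ)).add_const (cos θ * w)).const_mul σ
      have e : Θ' u = deriv T (cos θ * u - sin θ * w) * cos θ + σ * sin θ := by
        simp only [hΘ']; ring
      rw [e]
      exact ((h1.comp u h2).add h3).hasDerivWithinAt
    calc _ = ∫⁻ u, ENNReal.ofReal (Θ' u) * q (Θ u) := by
          refine lintegral_congr fun u => ?_
          have e1 : cos θ * (cos θ * u - sin θ * w) + sin θ * (sin θ * u + cos θ * w) = u := by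
            linear_combination u * (cos_sq_add_sin_sq θ)
          simp only [Pi.mul_apply, hF, ContinuousLinearMap.rotation_apply, cos_neg, sin_neg,
            smul_eq_mul, neg_mul, neg_neg, ← sub_eq_add_neg, e1]
          rw [ENNReal.mul_div_cancel (gaussianPDF_pos 0 one_ne_zero u).ne' gaussianPDF_ne_top,
            mul_comm]
      _ = ∫⁻ u in S, ENNReal.ofReal (Θ' u) * q (Θ u) := by
          rw [setLIntegral_congr (t := Set.univ), setLIntegral_univ]
          rw [ae_eq_univ]
          exact hSc.measure_zero _
      _ = ∫⁻ y in Θ '' S, q y :=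
          (lintegral_image_eq_lintegral_deriv_mul_of_monotoneOn hSm hder
            (hmono.monotoneOn S) q).symm
      _ ≤ ∫⁻ y, q y := setLIntegral_le_lintegral _ _
      _ ≤ 1 := hq1
  exact (lintegral_mono key).trans (by simp)

lemma log_gaussianPDFReal_zero {v : ℝ≥0} (hv : 0 < v) (x : ℝ) :
    log (gaussianPDFReal 0 v x) = -(1 / 2) * log (2 * π * v) - x ^ 2 / (2 * v) := by
  have hv' : (0 : ℝ) < v := hv
  rw [gaussianPDFReal_def]
  simp only [sub_zero]
  rw [log_mul (by positivity) (exp_pos _).ne', log_exp, log_inv, log_sqrt (by positivity)]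
  ring

lemma integrable_sq_gaussianReal (v : ℝ≥0) : Integrable (fun x => x ^ 2) (gaussianReal 0 v) :=
  (memLp_id_gaussianReal' 2 (by simp)).integrable_sq

lemma integral_sq_gaussianReal (v : ℝ≥0) : ∫ x, x ^ 2 ∂(gaussianReal 0 v) = v := by
  have := variance_fun_id_gaussianReal (μ := 0) (v := v)
  rw [variance_eq_integral measurable_id'.aemeasurable] at this
  simpa using this

lemma integrable_log_gaussianPDFReal {v : ℝ≥0} (hv : 0 < v) :
    Integrable (fun x => log (gaussianPDFReal 0 v x)) (gaussianReal 0 v) := by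
  simp only [log_gaussianPDFReal_zero hv]
  exact (integrable_const _).sub ((integrable_sq_gaussianReal v).div_const _)

lemma integral_log_gaussianPDFReal {v : ℝ≥0} (hv : 0 < v) :
    ∫ x, log (gaussianPDFReal 0 v x) ∂(gaussianReal 0 v)
      = -(1 / 2) * log (2 * π * rexp 1 * v) := by
  have hv' : (0 : ℝ) < v := hv
  simp only [log_gaussianPDFReal_zero hv]
  rw [integral_sub (integrable_const _) ((integrable_sq_gaussianReal v).div_const _),
    integral_div, integral_sq_gaussianReal]
  have : log (2 * π * rexp 1 * v) = log (2 * π * v) + 1 := by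
    rw [show 2 * π * rexp 1 * v = 2 * π * v * rexp 1 by ring,
      log_mul (by positivity) (exp_pos _).ne', log_exp]
  rw [this]
  simp
  field_simp
  ring

/-- The law of `cos θ * g + sin θ * z` for independent standard Gaussians `g`, `z`. -/
lemma measurePreserving_cos_add_sin (θ : ℝ) :
    MeasurePreserving (fun x : ℝ × ℝ => cos θ * x.1 + sin θ * x.2)
      ((gaussianReal 0 1).prod (gaussianReal 0 1)) (gaussianReal 0 1) := by
  have h1 : MeasurePreserving (ContinuousLinearMap.rotation (E := ℝ) θ)
      ((gaussianReal 0 1).prod (gaussianReal 0 1)) ((gaussianReal 0 1).prod (gaussianReal 0 1)) :=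
    ⟨(ContinuousLinearMap.rotation (E := ℝ) θ).measurable,
      IsGaussian.map_rotation_eq_self (by simp) θ⟩
  exact measurePreserving_fst.comp h1

/-- The entropy power inequality for the sum of `T g` and an independent Gaussian, where `T` is
a monotone function of a standard Gaussian `g`; `∫ log (deriv T)` is the differential entropy of
`T g` relative to that of `g`, and `- ∫ log q` is an upper bound for the one of the sum. -/
lemma integral_log_density_le {T : ℝ → ℝ} (hT : Monotone T) {K : Set ℝ} (hK : K.Countable)
    (hd : ∀ g ∉ K, DifferentiableAt ℝ T g) (hpos : ∀ g ∉ K, 0 < deriv T g)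
    (hL : Integrable (fun g => log (deriv T g)) (gaussianReal 0 1))
    {q : ℝ → ℝ} (hq : Measurable q) (hq0 : ∀ y, 0 < q y)
    (hq1 : ∫⁻ y, ENNReal.ofReal (q y) ≤ 1) {σ : ℝ} (hσ : 0 < σ)
    (hint : Integrable (fun x : ℝ × ℝ => log (q (T x.1 + σ * x.2)))
      ((gaussianReal 0 1).prod (gaussianReal 0 1))) :
    ∫ x : ℝ × ℝ, log (q (T x.1 + σ * x.2)) ∂((gaussianReal 0 1).prod (gaussianReal 0 1))
      ≤ -(1 / 2) * log (2 * π * rexp 1)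
        - 1 / 2 * log (rexp (2 * ∫ g, log (deriv T g) ∂(gaussianReal 0 1)) + σ ^ 2) := by
  set L := ∫ g, log (deriv T g) ∂(gaussianReal 0 1) with hLdef
  set N := rexp (2 * L) with hN
  have hN0 : 0 < N := exp_pos _
  set γ₂ := (gaussianReal 0 1).prod (gaussianReal 0 1)
  set M := N + σ ^ 2 with hM
  have hM0 : 0 < M := by positivity
  set a := √(N / M) with ha
  have ha0 : 0 < a := by positivity
  have ha2 : a ^ 2 = N / M := sq_sqrt (by positivity)
  have ha1 : a ≤ 1 := by
    rw [ha, sqrt_le_iff, one_pow, div_le_one hM0]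
    refine ⟨zero_le_one, ?_⟩
    have := sq_nonneg σ
    linarith
  set θ := arccos a with hθ
  have hcos : cos θ = a := cos_arccos (by linarith) ha1
  set b := sin θ with hb
  have hb2 : b ^ 2 = σ ^ 2 / M := by
    have h1 := sin_sq_add_cos_sq θ
    rw [hcos, ← hb, ha2] at h1
    rw [eq_sub_of_add_eq h1, hM]
    field_simp
    ring
  have hb0 : 0 < b := by
    have h1 : 0 ≤ b := sin_nonneg_of_mem_Icc ⟨arccos_nonneg a, arccos_le_pi a⟩
    have h2 : 0 < b ^ 2 := by rw [hb2]; positivity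
    exact lt_of_le_of_ne h1 (by rintro h; rw [← h] at h2; simp at h2)
  have hab : a ^ 2 + b ^ 2 = 1 := by rw [ha2, hb2, hM]; field_simp
  set G : ℝ × ℝ → ℝ := fun x => log (q (T x.1 + σ * x.2))
    + (a ^ 2 * (log (deriv T x.1) - log a) + b ^ 2 * (log σ - log b))
    - log (gaussianPDFReal 0 1 (cos θ * x.1 + sin θ * x.2)) with hG
  have hK0 : ∀ᵐ x ∂γ₂, x.1 ∉ K := by
    have : ∀ᵐ g ∂(gaussianReal 0 1), g ∉ K :=
      (gaussianReal_absolutelyContinuous 0 one_ne_zero).ae_le (hK.ae_notMem volume)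
    exact measurePreserving_fst.quasiMeasurePreserving.ae this
  have hi1 : Integrable (fun x : ℝ × ℝ => log (deriv T x.1)) γ₂ :=
    measurePreserving_fst.integrable_comp_of_integrable hL
  have hrot := measurePreserving_cos_add_sin θ
  have hi2 : Integrable (fun x : ℝ × ℝ =>
      log (gaussianPDFReal 0 1 (cos θ * x.1 + sin θ * x.2))) γ₂ :=
    hrot.integrable_comp_of_integrable (integrable_log_gaussianPDFReal one_pos)
  have hi3 : Integrable (fun x : ℝ × ℝ =>
      a ^ 2 * (log (deriv T x.1) - log a) + b ^ 2 * (log σ - log b)) γ₂ :=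
    ((hi1.sub (integrable_const _)).const_mul _).add (integrable_const _)
  have hiG : Integrable G γ₂ := (hint.add hi3).sub hi2
  have hexp : ∫⁻ x, ENNReal.ofReal (rexp (G x)) ∂γ₂ ≤ 1 := by
    refine le_trans (lintegral_mono_ae ?_) (lintegral_gaussian_rotation_le_one hT hK hd
      (q := fun y => ENNReal.ofReal (q y)) (by fun_prop) hq1 hσ.le (θ := θ)
      (by rw [hcos]; exact ha0) hb0.le)
    filter_upwards [hK0] with x hx
    have hφ := gaussianPDFReal_pos 0 1 (cos θ * x.1 + sin θ * x.2) one_ne_zero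
    have hT' := hpos _ hx
    rw [gaussianPDF, ← ENNReal.ofReal_mul (hq0 _).le, ← ENNReal.ofReal_div_of_pos hφ]
    refine ENNReal.ofReal_le_ofReal ?_
    rw [hG, exp_sub, exp_add, exp_log (hq0 _), exp_log hφ]
    gcongr
    · exact (hq0 _).le
    have hpos' : 0 < cos θ * deriv T x.1 + sin θ * σ := by rw [hcos]; positivity
    rw [← le_log_iff_exp_le hpos', ← log_div hT'.ne' ha0.ne', ← log_div hσ.ne' hb0.ne']
    have hconc := strictConcaveOn_log_Ioi.concaveOn.2 (x := deriv T x.1 / a) (y := σ / b)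
      (Set.mem_Ioi.2 (by positivity)) (Set.mem_Ioi.2 (by positivity)) (sq_nonneg a) (sq_nonneg b)
      hab
    simp only [smul_eq_mul] at hconc
    refine hconc.trans_eq ?_
    rw [hcos]
    congr 1
    rw [← hb]
    field_simp
  have hiexp : Integrable (fun x => rexp (G x)) γ₂ := by
    refine ⟨measurable_exp.comp_aemeasurable hiG.aemeasurable |>.aestronglyMeasurable, ?_⟩
    rw [hasFiniteIntegral_iff_ofReal (ae_of_all _ fun x => (exp_pos _).le)]
    exact hexp.trans_lt ENNReal.one_lt_top
  have hexp' : ∫ x, rexp (G x) ∂γ₂ ≤ 1 := by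
    rw [integral_eq_lintegral_of_nonneg_ae (ae_of_all _ fun x => (exp_pos _).le)
      hiexp.aestronglyMeasurable]
    exact ENNReal.toReal_le_of_le_ofReal zero_le_one (by simpa using hexp)
  have hG0 : ∫ x, G x ∂γ₂ ≤ 0 := by
    have h1 : ∫ x, (G x + 1) ∂γ₂ ≤ ∫ x, rexp (G x) ∂γ₂ :=
      integral_mono (hiG.add (integrable_const _)) hiexp fun x => add_one_le_exp _
    rw [integral_add hiG (integrable_const _)] at h1
    simp at h1
    linarith
  have e2 : ∫ x : ℝ × ℝ, log (deriv T x.1) ∂γ₂ = L := by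
    rw [integral_fun_fst (fun g => log (deriv T g))]
    simp [hLdef]
  have e3 : ∫ x : ℝ × ℝ, log (gaussianPDFReal 0 1 (cos θ * x.1 + sin θ * x.2)) ∂γ₂
      = -(1 / 2) * log (2 * π * rexp 1) := by
    have := integral_log_gaussianPDFReal (v := 1) one_pos
    rw [← hrot.map_eq, integral_map hrot.measurable.aemeasurable] at this
    · simpa using this
    · exact ((measurable_gaussianPDFReal 0 1).log).aestronglyMeasurable
  have hla : log a = 1 / 2 * (2 * L - log M) := by
    rw [ha, log_sqrt (by positivity), log_div hN0.ne' hM0.ne', hN, log_exp]; ring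
  have hlb : log b = 1 / 2 * (2 * log σ - log M) := by
    have : b = √(σ ^ 2 / M) := by rw [← hb2, sqrt_sq hb0.le]
    rw [this, log_sqrt (by positivity), log_div (by positivity) hM0.ne', log_pow]; push_cast; ring
  have s1 := integral_sub (hint.add hi3) hi2
  simp only [Pi.add_apply] at s1
  have s2 := integral_add ((hi1.sub (integrable_const (log a))).const_mul (a ^ 2))
    (integrable_const (b ^ 2 * (log σ - log b)))
  simp only [Pi.sub_apply] at s2
  rw [s1, integral_add hint hi3, s2, integral_const_mul, integral_sub hi1 (integrable_const _),
    e2, e3] at hG0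
  simp only [integral_const, probReal_univ, smul_eq_mul, one_mul] at hG0
  rw [hla, hlb] at hG0
  have : a ^ 2 * (L - 1 / 2 * (2 * L - log M)) + b ^ 2 * (log σ - 1 / 2 * (2 * log σ - log M))
      = 1 / 2 * log M := by linear_combination (1 / 2 * log M) * hab
  linarith

section AdditiveGaussian

variable {E : Type*} [MeasurableSpace E] (μ : Measure E) {f : E → ℝ} {v : ℝ≥0}

/-- The density of the output `f x + z` of an additive Gaussian channel with input law `μ`. -/
noncomputable def outputDensity (f : E → ℝ) (v : ℝ≥0) (y : ℝ) : ℝ≥0∞ :=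
  ∫⁻ x, gaussianPDF 0 v (y - f x) ∂μ

lemma measurable_gaussianPDF_sub (hf : Measurable f) :
    Measurable fun p : E × ℝ => gaussianPDF 0 v (p.2 - f p.1) :=
  (measurable_gaussianPDF 0 v).comp (measurable_snd.sub (hf.comp measurable_fst))

lemma map_fst_add_gaussian (hf : Measurable f) :
    ((μ.prod (gaussianReal 0 v)).map (fun p => (p.1, f p.1 + p.2))).map Prod.fst = μ := by
  rw [Measure.map_map measurable_fst (by fun_prop)]
  exact measurePreserving_fst.map_eq

lemma map_add_gaussian_eq_withDensity (hf : Measurable f) (hv : 0 < v) :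
    (μ.prod (gaussianReal 0 v)).map (fun p => (p.1, f p.1 + p.2))
      = (μ.prod volume).withDensity (fun p => gaussianPDF 0 v (p.2 - f p.1)) := by
  refine Measure.ext_of_lintegral _ fun φ hφ => ?_
  have hm : Measurable fun p : E × ℝ => (p.1, f p.1 + p.2) := by fun_prop
  have hg := measurable_gaussianPDF_sub (v := v) hf
  have hg0 := measurable_gaussianPDF 0 v
  rw [lintegral_map hφ hm, lintegral_withDensity_eq_lintegral_mul _ hg hφ,
    lintegral_prod _ (by exact (hφ.comp hm).aemeasurable),
    lintegral_prod _ (hg.mul hφ).aemeasurable]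
  refine lintegral_congr fun x => ?_
  have hφx : Measurable fun y => φ (x, f x + y) := hφ.comp (by fun_prop)
  rw [gaussianReal_of_var_ne_zero _ hv.ne', lintegral_withDensity_eq_lintegral_mul _ hg0 hφx,
    ← lintegral_add_left_eq_self
      (fun y => ((fun p : E × ℝ => gaussianPDF 0 v (p.2 - f p.1)) * φ) (x, y)) (f x)]
  simp

variable [IsProbabilityMeasure μ]

lemma measurable_outputDensity (hf : Measurable f) : Measurable (outputDensity μ f v) :=
  (measurable_gaussianPDF_sub hf).lintegral_prod_left'

lemma outputDensity_pos (hf : Measurable f) (hv : 0 < v) (y : ℝ) : 0 < outputDensity μ f v y := by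
  have hm : Measurable fun x => gaussianPDF 0 v (y - f x) :=
    (measurable_gaussianPDF 0 v).comp (measurable_const.sub hf)
  rw [outputDensity, lintegral_pos_iff_support hm]
  have : Function.support (fun x => gaussianPDF 0 v (y - f x)) = Set.univ := by
    ext x
    simpa using (gaussianPDF_pos 0 hv.ne' (y - f x)).ne'
  simp [this]

lemma outputDensity_lt_top (y : ℝ) : outputDensity μ f v y < ∞ := by
  have h : ∀ x, gaussianPDF 0 v (y - f x) ≤ ENNReal.ofReal (√(2 * π * v))⁻¹ := by
    intro x
    rw [gaussianPDF, gaussianPDFReal_def]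
    refine ENNReal.ofReal_le_ofReal (mul_le_of_le_one_right (by positivity) ?_)
    rw [exp_le_one_iff]
    exact div_nonpos_of_nonpos_of_nonneg (neg_nonpos.2 (sq_nonneg _)) (by positivity)
  calc _ ≤ ∫⁻ _, ENNReal.ofReal (√(2 * π * v))⁻¹ ∂μ := lintegral_mono h
    _ < ∞ := by rw [lintegral_const, measure_univ, mul_one]; exact ENNReal.ofReal_lt_top

lemma map_snd_add_gaussian (hf : Measurable f) (hv : 0 < v) :
    ((μ.prod (gaussianReal 0 v)).map (fun p => (p.1, f p.1 + p.2))).map Prod.snd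
      = volume.withDensity (outputDensity μ f v) := by
  rw [map_add_gaussian_eq_withDensity μ hf hv]
  refine Measure.ext_of_lintegral _ fun φ hφ => ?_
  have hg := measurable_gaussianPDF_sub (v := v) hf
  have hφ2 : Measurable fun p : E × ℝ => φ p.2 := hφ.comp measurable_snd
  rw [lintegral_map hφ measurable_snd, lintegral_withDensity_eq_lintegral_mul _ hg hφ2,
    lintegral_withDensity_eq_lintegral_mul _ (measurable_outputDensity μ hf) hφ,
    lintegral_prod_symm _ (hg.mul hφ2).aemeasurable]
  refine lintegral_congr fun y => ?_
  simp only [Pi.mul_apply, outputDensity]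
  rw [lintegral_mul_const]
  exact (measurable_gaussianPDF 0 v).comp (measurable_const.sub hf)

lemma lintegral_outputDensity (hf : Measurable f) (hv : 0 < v) :
    ∫⁻ y, outputDensity μ f v y = 1 := by
  have h := map_snd_add_gaussian (v := v) μ hf hv
  have h1 := congrArg (fun ν : Measure ℝ => ν Set.univ) h
  simp only [withDensity_apply _ MeasurableSet.univ, Measure.restrict_univ] at h1
  rw [← h1, Measure.map_map measurable_snd (by fun_prop), Measure.map_apply (by fun_prop) .univ]
  simp

/-- The mutual information of an additive Gaussian channel is at least `M` as soon as the
differential entropy of the output exceeds that of the noise by at least `M`. -/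
lemma le_mutualInfo_add_gaussian (hf : Measurable f) (hv : 0 < v) {M : ℝ}
    (hM : Integrable (fun p : E × ℝ => log (outputDensity μ f v (f p.1 + p.2)).toReal)
        (μ.prod (gaussianReal 0 v)) →
      ∫ p : E × ℝ, log (outputDensity μ f v (f p.1 + p.2)).toReal ∂(μ.prod (gaussianReal 0 v))
        ≤ -(1 / 2) * log (2 * π * rexp 1 * v) - M) :
    (M : EReal) ≤
      mutualInfo ((μ.prod (gaussianReal 0 v)).map (fun p => (p.1, f p.1 + p.2))) := by
  set J := (μ.prod (gaussianReal 0 v)).map (fun p => (p.1, f p.1 + p.2)) with hJ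
  set q := outputDensity μ f v with hq
  have hqm : Measurable q := measurable_outputDensity μ hf
  have hg := measurable_gaussianPDF_sub (v := v) hf
  have hm : Measurable fun p : E × ℝ => (p.1, f p.1 + p.2) := by fun_prop
  have : IsProbabilityMeasure J := Measure.isProbabilityMeasure_map hm.aemeasurable
  rw [mutualInfo, hJ, map_fst_add_gaussian μ hf, map_snd_add_gaussian μ hf hv, ← hJ, ← hq]
  set P := μ.prod (volume.withDensity q) with hP
  have : IsProbabilityMeasure (volume.withDensity q) := by
    rw [hq, ← map_snd_add_gaussian μ hf hv]
    exact Measure.isProbabilityMeasure_map measurable_snd.aemeasurable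
  rw [klDiv]
  split_ifs with hkl
  swap
  · exact le_top
  set r : E × ℝ → ℝ≥0∞ := fun p => gaussianPDF 0 v (p.2 - f p.1) / q p.2 with hr
  have hrm : Measurable r := hg.div (hqm.comp measurable_snd)
  have hJP : J = P.withDensity r := by
    rw [hP, prod_withDensity_right hqm, ← withDensity_mul _ (by fun_prop) hrm, hJ,
      map_add_gaussian_eq_withDensity μ hf hv]
    congr 1
    ext p
    simp only [hr, Pi.mul_apply]
    rw [ENNReal.mul_div_cancel (outputDensity_pos μ hf hv _).ne' (outputDensity_lt_top μ _).ne]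
  have hllr : llr J P =ᵐ[J] fun p => log (r p).toReal := by
    refine hkl.1.ae_le ?_
    have := Measure.rnDeriv_withDensity P hrm
    rw [← hJP] at this
    filter_upwards [this] with p hp
    rw [llr, hp]
  have hlog : ∀ p : E × ℝ, log (r (p.1, f p.1 + p.2)).toReal
      = log (gaussianPDFReal 0 v p.2) - log (q (f p.1 + p.2)).toReal := by
    intro p
    have hq0 := outputDensity_pos μ hf hv (f p.1 + p.2)
    simp only [hr, add_sub_cancel_left, ENNReal.toReal_div, toReal_gaussianPDF]
    rw [log_div (gaussianPDFReal_pos 0 v p.2 hv.ne').ne'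
      (ENNReal.toReal_pos hq0.ne' (outputDensity_lt_top μ _).ne).ne']
  have hint : Integrable (fun p => log (r p).toReal) J := (integrable_congr hllr).1 hkl.2
  have hlm : Measurable fun p => log (r p).toReal := hrm.ennreal_toReal.log
  rw [hJ, integrable_map_measure hlm.aestronglyMeasurable hm.aemeasurable] at hint
  simp only [Function.comp_def, hlog] at hint
  have hiz : Integrable (fun p : E × ℝ => log (gaussianPDFReal 0 v p.2))
      (μ.prod (gaussianReal 0 v)) :=
    measurePreserving_snd.integrable_comp_of_integrable (integrable_log_gaussianPDFReal hv)
  have hiq : Integrable (fun p : E × ℝ => log (q (f p.1 + p.2)).toReal)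
      (μ.prod (gaussianReal 0 v)) := by
    refine (hiz.sub hint).congr (ae_of_all _ fun p => ?_)
    simp
  rw [integral_congr_ae hllr, hJ, integral_map hm.aemeasurable hlm.aestronglyMeasurable]
  simp only [hlog]
  rw [integral_sub hiz hiq, integral_fun_snd (fun z => log (gaussianPDFReal 0 v z)),
    integral_log_gaussianPDFReal hv]
  have := hM hiq
  simp only [probReal_univ, one_smul, EReal.coe_le_coe_iff]
  linarith

end AdditiveGaussian

lemma map_prod_gaussianReal {E : Type*} [MeasurableSpace E] {X : ℝ → E} (hX : Measurable X)
    (v : ℝ≥0) :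
    ((gaussianReal 0 1).map X).prod (gaussianReal 0 v)
      = ((gaussianReal 0 1).prod (gaussianReal 0 1)).map (fun p => (X p.1, √v * p.2)) := by
  have h : gaussianReal 0 v = (gaussianReal 0 1).map (fun z => √v * z) := by
    rw [gaussianReal_map_const_mul]
    congr 1
    · simp
    · ext; simp
  rw [h, Measure.map_prod_map _ _ hX (by fun_prop)]
  rfl

/-- A lower bound on the mutual information over an additive Gaussian channel whose input is a
function of a standard Gaussian that increases the scalar channel input `f`. -/
lemma le_mutualInfo_of_monotone_gaussian {E : Type*} [MeasurableSpace E] {X : ℝ → E}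
    (hX : Measurable X) {f : E → ℝ} (hf : Measurable f) (hT : Monotone fun g => f (X g))
    {K : Set ℝ} (hK : K.Countable) (hd : ∀ g ∉ K, DifferentiableAt ℝ (fun g => f (X g)) g)
    (hpos : ∀ g ∉ K, 0 < deriv (fun g => f (X g)) g)
    (hL : Integrable (fun g => log (deriv (fun g => f (X g)) g)) (gaussianReal 0 1))
    {v : ℝ≥0} (hv : 0 < v) :
    ((1 / 2 * log (1 + rexp (2 * ∫ g, log (deriv (fun g => f (X g)) g) ∂(gaussianReal 0 1)) / v) :
        ℝ) : EReal)
      ≤ mutualInfo ((((gaussianReal 0 1).map X).prod (gaussianReal 0 v)).map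
          (fun p => (p.1, f p.1 + p.2))) := by
  have hv' : (0 : ℝ) < v := hv
  have : IsProbabilityMeasure ((gaussianReal 0 1).map X) :=
    Measure.isProbabilityMeasure_map hX.aemeasurable
  set μ := (gaussianReal 0 1).map X with hμ
  refine le_mutualInfo_add_gaussian μ hf hv fun hi => ?_
  have hqm : Measurable fun y => (outputDensity μ f v y).toReal :=
    (measurable_outputDensity μ hf).ennreal_toReal
  have hm : Measurable fun p : ℝ × ℝ => (X p.1, √v * p.2) := by fun_prop
  have hqm' : Measurable fun p : E × ℝ => log (outputDensity μ f v (f p.1 + p.2)).toReal :=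
    (hqm.comp (f := fun p : E × ℝ => f p.1 + p.2) (by fun_prop)).log
  have key := integral_log_density_le hT hK hd hpos hL hqm
    (fun y => ENNReal.toReal_pos (outputDensity_pos μ hf hv y).ne' (outputDensity_lt_top μ y).ne)
    (by simp only [ENNReal.ofReal_toReal (outputDensity_lt_top μ _).ne]
        exact (lintegral_outputDensity μ hf hv).le)
    (σ := √v) (by positivity)
  rw [hμ, map_prod_gaussianReal hX, ← hμ, integrable_map_measure hqm'.aestronglyMeasurable
    hm.aemeasurable] at hi
  rw [hμ, map_prod_gaussianReal hX, ← hμ, integral_map hm.aemeasurable hqm'.aestronglyMeasurable]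
  refine (key hi).trans_eq ?_
  set N := rexp (2 * ∫ g, log (deriv (fun g => f (X g)) g) ∂(gaussianReal 0 1)) with hN
  have hN0 : 0 < N := exp_pos _
  rw [sq_sqrt hv'.le, show 1 + N / v = (N + v) / v by field_simp; ring,
    log_div (by positivity) hv'.ne', log_mul (by positivity) hv'.ne']
  ring

lemma hasDerivAt_cdf_gaussianReal {m : ℝ} {v : ℝ≥0} (hv : v ≠ 0) (g : ℝ) :
    HasDerivAt (cdf (gaussianReal m v)) (gaussianPDFReal m v g) g := by
  have hi := integrable_gaussianPDFReal m v
  have h : ∀ x, cdf (gaussianReal m v) x = ∫ t in Set.Iic x, gaussianPDFReal m v t := by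
    intro x
    rw [cdf_eq_real, measureReal_def, gaussianReal_apply_eq_integral _ hv,
      ENNReal.toReal_ofReal (integral_nonneg (gaussianPDFReal_nonneg m v))]
  have h2 : ⇑(cdf (gaussianReal m v)) =
      fun x => cdf (gaussianReal m v) 0 + ∫ t in (0 : ℝ)..x, gaussianPDFReal m v t := by
    ext x
    rw [← intervalIntegral.integral_Iic_sub_Iic hi.integrableOn hi.integrableOn, ← h, ← h]
    ring
  have hc : Continuous (gaussianPDFReal m v) := by
    rw [gaussianPDFReal_def]; fun_prop
  rw [h2]
  exact (intervalIntegral.integral_hasDerivAt_right (hc.intervalIntegrable _ _)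
    (hc.stronglyMeasurableAtFilter _ _) hc.continuousAt).const_add _

lemma strictMono_cdf_gaussianReal {m : ℝ} {v : ℝ≥0} (hv : v ≠ 0) :
    StrictMono (cdf (gaussianReal m v)) :=
  strictMono_of_deriv_pos fun g => by
    rw [(hasDerivAt_cdf_gaussianReal hv g).deriv]; exact gaussianPDFReal_pos m v g hv

lemma range_cdf_gaussianReal {m : ℝ} {v : ℝ≥0} (hv : v ≠ 0) :
    Set.range (cdf (gaussianReal m v)) = Set.Ioo 0 1 := by
  have hmono := strictMono_cdf_gaussianReal (m := m) hv
  ext u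
  constructor
  · rintro ⟨g, rfl⟩
    exact ⟨(cdf_nonneg _ (g - 1)).trans_lt (hmono (by linarith)),
      (hmono (by linarith : g < g + 1)).trans_le (cdf_le_one _ _)⟩
  · rintro ⟨h0, h1⟩
    refine mem_range_of_exists_le_of_exists_ge
      (continuous_iff_continuousAt.2 fun g => (hasDerivAt_cdf_gaussianReal hv g).continuousAt) ?_ ?_
    · exact ((tendsto_cdf_atBot _).eventually_le_const h0).exists
    · exact ((tendsto_cdf_atTop _).eventually_const_le h1).exists

/-- The distribution function of a nondegenerate Gaussian maps it to the uniform law. -/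
lemma measurePreserving_cdf_gaussianReal {m : ℝ} {v : ℝ≥0} (hv : v ≠ 0) :
    MeasurePreserving (cdf (gaussianReal m v)) (gaussianReal m v)
      (volume.restrict (Set.Ioo 0 1)) := by
  have hm : Measurable (cdf (gaussianReal m v)) := (monotone_cdf _).measurable
  refine ⟨hm, Measure.ext_of_lintegral _ fun φ hφ => ?_⟩
  have hφm : Measurable fun g => φ (cdf (gaussianReal m v) g) := hφ.comp hm
  rw [lintegral_map hφ hm, ← range_cdf_gaussianReal (m := m) hv, ← Set.image_univ,
    lintegral_image_eq_lintegral_deriv_mul_of_monotoneOn MeasurableSet.univ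
      (fun g _ => (hasDerivAt_cdf_gaussianReal hv g).hasDerivWithinAt)
      ((monotone_cdf _).monotoneOn _),
    setLIntegral_univ]
  nth_rewrite 1 [gaussianReal_of_var_ne_zero m hv]
  rw [lintegral_withDensity_eq_lintegral_mul _ (measurable_gaussianPDF m v) hφm]
  rfl

/-- A lower bound on the mutual information over an additive Gaussian channel whose input is a
function of a uniform random variable that increases the scalar channel input `f`. -/
lemma le_mutualInfo_of_monotone_uniform {E : Type*} [MeasurableSpace E] {X : ℝ → E}
    (hX : Measurable X) {f : E → ℝ} (hf : Measurable f) (hQ : Monotone fun u => f (X u))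
    {K : Set ℝ} (hK : K.Countable)
    (hd : ∀ u ∈ Set.Ioo (0 : ℝ) 1 \ K, DifferentiableAt ℝ (fun u => f (X u)) u)
    (hpos : ∀ u ∈ Set.Ioo (0 : ℝ) 1 \ K, 0 < deriv (fun u => f (X u)) u)
    (hL : IntegrableOn (fun u => log (deriv (fun u => f (X u)) u)) (Set.Ioo 0 1))
    {v : ℝ≥0} (hv : 0 < v) :
    ((1 / 2 * log (1 + rexp (2 * ∫ u in Set.Ioo (0 : ℝ) 1, log (deriv (fun u => f (X u)) u))
        / (2 * π * rexp 1 * v)) : ℝ) : EReal)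
      ≤ mutualInfo ((((volume.restrict (Set.Ioo (0 : ℝ) 1)).map X).prod (gaussianReal 0 v)).map
          (fun p => (p.1, f p.1 + p.2))) := by
  set Φ : ℝ → ℝ := ⇑(cdf (gaussianReal 0 1))
  have hΦd := hasDerivAt_cdf_gaussianReal (m := 0) (v := 1) one_ne_zero
  have hΦp := measurePreserving_cdf_gaussianReal (m := 0) (v := 1) one_ne_zero
  have hΦm : Measurable Φ := hΦp.measurable
  have hΦI : ∀ g, Φ g ∈ Set.Ioo (0 : ℝ) 1 := fun g =>
    range_cdf_gaussianReal (m := 0) (v := 1) one_ne_zero ▸ Set.mem_range_self g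
  have hφpos : ∀ g, 0 < gaussianPDFReal 0 1 g := fun g => gaussianPDFReal_pos 0 1 g one_ne_zero
  set K' := Φ ⁻¹' K with hK'
  have hK'c : K'.Countable := hK.preimage_of_injOn
    (strictMono_cdf_gaussianReal (m := 0) (v := 1) one_ne_zero).injective.injOn
  set Q : ℝ → ℝ := fun u => f (X u) with hQdef
  have hder : ∀ g ∉ K', HasDerivAt (fun g => f (X (Φ g)))
      (deriv Q (Φ g) * gaussianPDFReal 0 1 g) g := fun g hg =>
    (hd (Φ g) ⟨hΦI g, hg⟩).hasDerivAt.comp g (hΦd g)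
  have hae : ∀ᵐ g ∂(gaussianReal 0 1), log (deriv (fun g => f (X (Φ g))) g)
      = log (deriv Q (Φ g)) + log (gaussianPDFReal 0 1 g) := by
    have : ∀ᵐ g ∂(gaussianReal 0 1), g ∉ K' :=
      (gaussianReal_absolutelyContinuous 0 one_ne_zero).ae_le (hK'c.ae_notMem volume)
    filter_upwards [this] with g hg
    rw [(hder g hg).deriv, log_mul (hpos _ ⟨hΦI g, hg⟩).ne' (hφpos g).ne']
  have hi1 : Integrable (fun g => log (deriv Q (Φ g))) (gaussianReal 0 1) :=
    hΦp.integrable_comp_of_integrable hL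
  have hi2 := integrable_log_gaussianPDFReal (v := 1) one_pos
  have hlm : Measurable fun u => log (deriv Q u) := (measurable_deriv Q).log
  have hint : ∫ g, log (deriv (fun g => f (X (Φ g))) g) ∂(gaussianReal 0 1)
      = (∫ u in Set.Ioo (0 : ℝ) 1, log (deriv Q u)) - 1 / 2 * log (2 * π * rexp 1) := by
    rw [integral_congr_ae hae, integral_add hi1 hi2, integral_log_gaussianPDFReal one_pos,
      ← hΦp.map_eq, integral_map hΦm.aemeasurable hlm.aestronglyMeasurable]
    simp only [NNReal.coe_one, mul_one]
    ring
  have key := le_mutualInfo_of_monotone_gaussian (X := fun g => X (Φ g)) (hX.comp hΦm) hf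
    (fun x y hxy => hQ (monotone_cdf _ hxy)) hK'c (fun g hg => (hder g hg).differentiableAt)
    (fun g hg => by
      rw [(hder g hg).deriv]; exact mul_pos (hpos _ ⟨hΦI g, hg⟩) (hφpos g))
    ((integrable_congr hae).2 (hi1.add hi2)) hv
  rw [hint] at key
  have hmap : (gaussianReal 0 1).map (fun g => X (Φ g))
      = (volume.restrict (Set.Ioo (0 : ℝ) 1)).map X := by
    rw [← hΦp.map_eq, Measure.map_map hX hΦm]; rfl
  rw [hmap] at key
  convert key using 5
  rw [mul_sub, exp_sub, ← mul_assoc, mul_one_div_cancel two_ne_zero, one_mul,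
    exp_log (by positivity), div_div]

section CumulativeSum

variable {n : ℕ} {p : Fin n → ℝ}

@[simp] lemma sCum_zero (p : Fin n → ℝ) : sCum p 0 = 0 := by simp [sCum]

lemma sCum_self (p : Fin n → ℝ) : sCum p n = ∑ k, p k := by simp [sCum]

lemma sCum_succ (p : Fin n → ℝ) (k : Fin n) : sCum p (k.val + 1) = sCum p k.val + p k := by
  have : p k = ∑ i, if i = k then p i else 0 := by simp
  rw [sCum, sCum, this, ← Finset.sum_add_distrib]
  refine Finset.sum_congr rfl fun i _ => ?_
  rcases lt_trichotomy i k with hik | rfl | hik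
  · simp [hik.ne, hik, Nat.lt_succ_of_lt (Fin.lt_def.1 hik)]
  · simp
  · simp [hik.ne', hik.not_gt, show ¬ i.val < k.val + 1 by have := Fin.lt_def.1 hik; omega]

lemma monotone_sCum (hp : ∀ k, 0 ≤ p k) : Monotone (sCum p) := by
  intro a b hab
  refine Finset.sum_le_sum fun i _ => ?_
  split_ifs with h1 h2
  · exact le_rfl
  · omega
  · exact hp i
  · exact le_rfl

lemma sum_one_sub_sCum_succ (hp : ∑ k, p k = 1) :
    ∑ k : Fin n, (1 - sCum p (k.val + 1)) = ∑ k : Fin n, p k * (k.val : ℝ) := by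
  have h1 : ∀ k : Fin n, 1 - sCum p (k.val + 1) = ∑ i : Fin n, if k < i then p i else 0 := by
    intro k
    rw [← hp, sCum, ← Finset.sum_sub_distrib]
    refine Finset.sum_congr rfl fun i _ => ?_
    simp only [Fin.lt_def]
    split_ifs <;> first | omega | simp
  simp_rw [h1]
  rw [Finset.sum_comm]
  refine Finset.sum_congr rfl fun i _ => ?_
  rw [← Finset.sum_filter, Finset.sum_const, Finset.filter_gt_eq_Iio, Fin.card_Iio, nsmul_eq_mul,
    mul_comm]

lemma exists_mem_Ioo_sCum {u : ℝ} (hu : 0 < u) (hK : ∀ k, u ≠ sCum p k) {m : ℕ} (hm : m ≤ n)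
    (hum : u < sCum p m) : ∃ j : Fin n, u ∈ Set.Ioo (sCum p j.val) (sCum p (j.val + 1)) := by
  induction m with
  | zero => simp at hum; linarith
  | succ m ih =>
    rcases lt_or_gt_of_ne (hK m) with h | h
    · exact ih (by omega) h
    · exact ⟨⟨m, hm⟩, h, hum⟩

end CumulativeSum

section StackedInput

/-- The input obtained by filling the coordinates one after the other as `u` runs through the
consecutive intervals of lengths `p k`, each along the profile `A * τ`. -/
noncomputable def stackedInput {n : ℕ} (p : Fin n → ℝ) (A : ℝ) (τ : ℝ → ℝ) (u : ℝ)
    (k : Fin n) : ℝ :=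
  A * τ (max 0 (min 1 ((u - sCum p k.val) / p k)))

variable {n : ℕ} {p : Fin n → ℝ} {A : ℝ} {τ τ' : ℝ → ℝ}

lemma stackedInput_of_le (hp : ∀ k, 0 < p k) (h0 : τ 0 = 0) {u : ℝ} {k : Fin n}
    (hu : u ≤ sCum p k.val) :
    stackedInput p A τ u k = 0 := by
  have h : (u - sCum p k.val) / p k ≤ 0 := div_nonpos_of_nonpos_of_nonneg (by linarith) (hp k).le
  rw [stackedInput, max_eq_left ((min_le_right _ _).trans h), h0, mul_zero]

lemma stackedInput_of_ge (hp : ∀ k, 0 < p k) (h1 : τ 1 = 1) {u : ℝ} {k : Fin n}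
    (hu : sCum p (k.val + 1) ≤ u) :
    stackedInput p A τ u k = A := by
  rw [sCum_succ] at hu
  have h : 1 ≤ (u - sCum p k.val) / p k := by rw [le_div_iff₀ (hp k)]; linarith
  rw [stackedInput, min_eq_left h, max_eq_right zero_le_one, h1, mul_one]

lemma div_mem_Ioo_of_mem_Ioo_sCum (hp : ∀ k, 0 < p k) {u : ℝ} {k : Fin n}
    (hu : u ∈ Set.Ioo (sCum p k.val) (sCum p (k.val + 1))) :
    (u - sCum p k.val) / p k ∈ Set.Ioo (0 : ℝ) 1 := by
  rw [sCum_succ] at hu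
  exact ⟨div_pos (by linarith [hu.1]) (hp k), by rw [div_lt_one (hp k)]; linarith [hu.2]⟩

lemma stackedInput_of_mem_Ioo (hp : ∀ k, 0 < p k) {u : ℝ} {k : Fin n}
    (hu : u ∈ Set.Ioo (sCum p k.val) (sCum p (k.val + 1))) :
    stackedInput p A τ u k = A * τ ((u - sCum p k.val) / p k) := by
  have h := div_mem_Ioo_of_mem_Ioo_sCum hp hu
  rw [stackedInput, min_eq_right h.2.le, max_eq_right h.1.le]

lemma monotone_stackedInput (hp : ∀ k, 0 < p k) (hA : 0 < A) (hτ : MonotoneOn τ (Set.Icc 0 1))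
    (k : Fin n) :
    Monotone fun u => stackedInput p A τ u k := by
  intro u w huw
  have hI : ∀ x : ℝ, max 0 (min 1 x) ∈ Set.Icc (0 : ℝ) 1 := fun x => ⟨le_max_left _ _, by simp⟩
  refine mul_le_mul_of_nonneg_left (hτ (hI _) (hI _) ?_) hA.le
  have := (hp k).le
  gcongr

lemma stackedInput_mem_Icc (hp : ∀ k, 0 < p k) (hA : 0 < A) (h0 : τ 0 = 0) (h1 : τ 1 = 1)
    (hτ : MonotoneOn τ (Set.Icc 0 1)) (u : ℝ) (k : Fin n) :
    stackedInput p A τ u k ∈ Set.Icc 0 A := by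
  have hm := monotone_stackedInput hp hA hτ k
  have hI : max 0 (min 1 ((u - sCum p k.val) / p k)) ∈ Set.Icc (0 : ℝ) 1 :=
    ⟨le_max_left _ _, by simp⟩
  constructor
  · refine mul_nonneg hA.le ?_
    simpa [h0] using hτ (by simp) hI hI.1
  · refine mul_le_of_le_one_right hA.le ?_
    simpa [h1] using hτ hI (by simp) hI.2

lemma hasDerivAt_sum_stackedInput (hp : ∀ k, 0 < p k) (h0 : τ 0 = 0) (h1 : τ 1 = 1)
    (hd : ∀ t ∈ Set.Ioo (0 : ℝ) 1, HasDerivAt τ (τ' t) t) (h : Fin n → ℝ) {u : ℝ} {j : Fin n}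
    (hu : u ∈ Set.Ioo (sCum p j.val) (sCum p (j.val + 1))) :
    HasDerivAt (fun u => ∑ k, h k * stackedInput p A τ u k)
      (A * h j / p j * τ' ((u - sCum p j.val) / p j)) u := by
  have hmono := monotone_sCum fun k => (hp k).le
  have hk : ∀ k ∈ Finset.univ, HasDerivAt (fun u => h k * stackedInput p A τ u k)
      (if k = j then A * h j / p j * τ' ((u - sCum p j.val) / p j) else 0) u := by
    intro k _
    rcases lt_trichotomy k j with hkj | rfl | hkj
    · rw [if_neg hkj.ne]
      refine (hasDerivAt_const u (h k * A)).congr_of_eventuallyEq ?_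
      filter_upwards [eventually_gt_nhds hu.1] with w hw
      rw [stackedInput_of_ge hp h1 ((hmono (Nat.succ_le_of_lt (Fin.lt_def.1 hkj))).trans hw.le)]
    · rw [if_pos rfl]
      have hin : HasDerivAt (fun w => (w - sCum p k.val) / p k) (1 / p k) u :=
        ((hasDerivAt_id u).sub_const _).div_const _
      have := (((hd _ (div_mem_Ioo_of_mem_Ioo_sCum hp hu)).comp u hin).const_mul A).const_mul (h k)
      refine (this.congr_of_eventuallyEq ?_).congr_deriv (by ring)
      filter_upwards [isOpen_Ioo.mem_nhds hu] with w hw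
      rw [stackedInput_of_mem_Ioo hp hw]; rfl
    · rw [if_neg hkj.ne']
      refine (hasDerivAt_const u 0).congr_of_eventuallyEq ?_
      filter_upwards [eventually_lt_nhds hu.2] with w hw
      rw [stackedInput_of_le hp h0 (hw.le.trans (hmono (Nat.succ_le_of_lt (Fin.lt_def.1 hkj)))),
        mul_zero]
  simpa using HasDerivAt.fun_sum hk

lemma integral_comp_sub_sCum_div (hp : ∀ k, 0 < p k) (g : ℝ → ℝ) (k : Fin n) :
    ∫ u in sCum p k.val..sCum p (k.val + 1), g ((u - sCum p k.val) / p k)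
      = p k * ∫ t in (0 : ℝ)..1, g t := by
  simp_rw [sub_div]
  rw [intervalIntegral.integral_comp_div_sub _ (hp k).ne', sCum_succ, ← sub_div, ← sub_div,
    sub_self, add_sub_cancel_left, zero_div, div_self (hp k).ne', smul_eq_mul]

lemma intervalIntegrable_comp_sub_sCum_div (hp : ∀ k, 0 < p k) {g : ℝ → ℝ}
    (hg : ContinuousOn g (Set.Icc 0 1)) (k : Fin n) :
    IntervalIntegrable (fun u => g ((u - sCum p k.val) / p k)) volume
      (sCum p k.val) (sCum p (k.val + 1)) := by
  refine ContinuousOn.intervalIntegrable ?_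
  rw [sCum_succ, Set.uIcc_of_le (by linarith [hp k])]
  refine hg.comp (by fun_prop) fun u hu => ⟨div_nonneg (by linarith [hu.1]) (hp k).le, ?_⟩
  rw [div_le_one (hp k)]; linarith [hu.2]

/-- An integral over the unit interval, computed on the consecutive intervals of lengths `p k`. -/
lemma integral_Ioo_of_eqOn_Ioo_sCum (hp : ∀ k, 0 < p k) (hs : ∑ k, p k = 1) {G : ℝ → ℝ}
    {g : Fin n → ℝ → ℝ} (hg : ∀ k, ContinuousOn (g k) (Set.Icc 0 1))
    (hG : ∀ k : Fin n, ∀ u ∈ Set.Ioo (sCum p k.val) (sCum p (k.val + 1)),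
      G u = g k ((u - sCum p k.val) / p k)) :
    IntegrableOn G (Set.Ioo 0 1) ∧
      ∫ u in Set.Ioo (0 : ℝ) 1, G u = ∑ k, p k * ∫ t in (0 : ℝ)..1, g k t := by
  have hlt : ∀ k : Fin n, sCum p k.val ≤ sCum p (k.val + 1) := fun k => by
    rw [sCum_succ]; linarith [hp k]
  have hi : ∀ k : Fin n, IntervalIntegrable G volume (sCum p k.val) (sCum p (k.val + 1)) := by
    intro k
    have := intervalIntegrable_comp_sub_sCum_div hp (hg k) k
    rw [intervalIntegrable_iff_integrableOn_Ioo_of_le (hlt k)] at this ⊢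
    exact this.congr_fun (fun u hu => (hG k u hu).symm) measurableSet_Ioo
  have hi' : ∀ k < n, IntervalIntegrable G volume (sCum p k) (sCum p (k + 1)) :=
    fun k hk => hi ⟨k, hk⟩
  have h0n : sCum p n = 1 := by rw [sCum_self, hs]
  have hI := IntervalIntegrable.trans_iterate hi'
  have hS := intervalIntegral.sum_integral_adjacent_intervals hi'
  rw [sCum_zero, h0n] at hI hS
  refine ⟨(intervalIntegrable_iff_integrableOn_Ioo_of_le zero_le_one).1 hI, ?_⟩
  rw [← integral_Ioc_eq_integral_Ioo, ← intervalIntegral.integral_of_le zero_le_one, ← hS,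
    Finset.sum_range]
  refine Finset.sum_congr rfl fun k _ => ?_
  rw [← integral_comp_sub_sCum_div hp, intervalIntegral.integral_of_le (hlt k),
    intervalIntegral.integral_of_le (hlt k), integral_Ioc_eq_integral_Ioo,
    integral_Ioc_eq_integral_Ioo]
  exact setIntegral_congr_fun measurableSet_Ioo (hG k)

lemma integral_stackedInput (hp : ∀ k, 0 < p k) (h0 : τ 0 = 0) (h1 : τ 1 = 1)
    (hτ : ContinuousOn τ (Set.Icc 0 1)) (hs : ∑ k, p k = 1) (k : Fin n) :
    ∫ u in Set.Ioo (0 : ℝ) 1, stackedInput p A τ u k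
      = A * (p k * (∫ t in (0 : ℝ)..1, τ t) + (1 - sCum p (k.val + 1))) := by
  have hmono := monotone_sCum fun k => (hp k).le
  rw [(integral_Ioo_of_eqOn_Ioo_sCum hp hs
    (g := fun j t => if k = j then A * τ t else if k < j then A else 0) ?_ ?_).2]
  rotate_left
  · intro j
    split_ifs <;> fun_prop
  · intro j u hu
    rcases lt_trichotomy k j with hkj | rfl | hkj
    · rw [if_neg hkj.ne, if_pos hkj, stackedInput_of_ge hp h1
        ((hmono (Nat.succ_le_of_lt (Fin.lt_def.1 hkj))).trans hu.1.le)]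
    · rw [if_pos rfl, stackedInput_of_mem_Ioo hp hu]
    · rw [if_neg hkj.ne', if_neg hkj.not_gt, stackedInput_of_le hp h0
        (hu.2.le.trans (hmono (Nat.succ_le_of_lt (Fin.lt_def.1 hkj))))]
  have h : p k * (∫ t in (0 : ℝ)..1, τ t)
      = ∑ j, if k = j then p j * ∫ t in (0 : ℝ)..1, τ t else 0 := by
    simp
  have h' : 1 - sCum p (k.val + 1) = ∑ j, (p j - if j.val < k.val + 1 then p j else 0) := by
    rw [Finset.sum_sub_distrib, hs, sCum]
  rw [h, h', ← Finset.sum_add_distrib, Finset.mul_sum]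
  refine Finset.sum_congr rfl fun j _ => ?_
  rcases lt_trichotomy k j with hkj | rfl | hkj
  · have : ¬ j.val < k.val + 1 := by have := Fin.lt_def.1 hkj; omega
    simp [hkj, hkj.ne, this, mul_comm]
  · simp
    ring
  · have : j.val < k.val + 1 := by have := Fin.lt_def.1 hkj; omega
    simp [hkj.ne', hkj.not_gt, this]

end StackedInput

section TruncatedExponential

/-- The quantile function of the exponential law of rate `μ` truncated to `[0, 1]`. -/
noncomputable def truncExpQuantile (μ t : ℝ) : ℝ := -log (1 - (1 - rexp (-μ)) * t) / μ

variable {μ : ℝ}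

lemma truncExpQuantile_zero : truncExpQuantile μ 0 = 0 := by simp [truncExpQuantile]

lemma truncExpQuantile_one (hμ : 0 < μ) : truncExpQuantile μ 1 = 1 := by
  simp [truncExpQuantile, hμ.ne']

lemma one_sub_exp_neg_pos (hμ : 0 < μ) : 0 < 1 - rexp (-μ) := by
  rw [sub_pos, exp_lt_one_iff]; linarith

lemma one_sub_mul_pos (hμ : 0 < μ) {t : ℝ} (ht : t ≤ 1) : 0 < 1 - (1 - rexp (-μ)) * t := by
  nlinarith [one_sub_exp_neg_pos hμ, exp_pos (-μ)]

lemma hasDerivAt_truncExpQuantile (hμ : 0 < μ) {t : ℝ} (ht : t ≤ 1) :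
    HasDerivAt (truncExpQuantile μ)
      ((1 - rexp (-μ)) / (μ * (1 - (1 - rexp (-μ)) * t))) t := by
  have h := one_sub_mul_pos hμ ht
  have h1 : HasDerivAt (fun t => 1 - (1 - rexp (-μ)) * t) (-((1 - rexp (-μ)) * 1)) t :=
    ((hasDerivAt_id t).const_mul _).const_sub 1
  refine ((h1.log h.ne').neg.div_const μ).congr_deriv ?_
  field_simp

lemma deriv_truncExpQuantile_pos (hμ : 0 < μ) {t : ℝ} (ht : t ≤ 1) :
    0 < (1 - rexp (-μ)) / (μ * (1 - (1 - rexp (-μ)) * t)) :=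
  div_pos (one_sub_exp_neg_pos hμ) (mul_pos hμ (one_sub_mul_pos hμ ht))

lemma log_deriv_truncExpQuantile (hμ : 0 < μ) {t : ℝ} (ht : t ≤ 1) :
    log ((1 - rexp (-μ)) / (μ * (1 - (1 - rexp (-μ)) * t)))
      = μ * truncExpQuantile μ t - log (μ / (1 - rexp (-μ))) := by
  have h := one_sub_mul_pos hμ ht
  have hc := one_sub_exp_neg_pos hμ
  rw [truncExpQuantile, log_div hc.ne' (by positivity), log_mul hμ.ne' h.ne', log_div hμ.ne' hc.ne']
  field_simp
  ring

lemma continuousOn_truncExpQuantile (hμ : 0 < μ) :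
    ContinuousOn (truncExpQuantile μ) (Set.Icc 0 1) := fun _ ht =>
  (hasDerivAt_truncExpQuantile hμ ht.2).continuousAt.continuousWithinAt

lemma monotoneOn_truncExpQuantile (hμ : 0 < μ) :
    MonotoneOn (truncExpQuantile μ) (Set.Icc 0 1) := by
  intro s hs t ht hst
  have := one_sub_mul_pos hμ ht.2
  have := one_sub_exp_neg_pos hμ
  unfold truncExpQuantile
  gcongr

lemma integral_truncExpQuantile (hμ : 0 < μ) :
    ∫ t in (0 : ℝ)..1, truncExpQuantile μ t = 1 / μ - rexp (-μ) / (1 - rexp (-μ)) := by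
  have hc := one_sub_exp_neg_pos hμ
  have hd : ∀ t ∈ Set.uIcc (0 : ℝ) 1, HasDerivAt (fun t => (1 - (1 - rexp (-μ)) * t)
      * log (1 - (1 - rexp (-μ)) * t) / ((1 - rexp (-μ)) * μ) + t / μ)
      (truncExpQuantile μ t) t := by
    intro t ht
    rw [Set.uIcc_of_le zero_le_one] at ht
    have h := one_sub_mul_pos hμ ht.2
    have h1 : HasDerivAt (fun t => 1 - (1 - rexp (-μ)) * t) (-((1 - rexp (-μ)) * 1)) t :=
      ((hasDerivAt_id t).const_mul _).const_sub 1
    refine (((h1.mul (h1.log h.ne')).div_const _).add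
      ((hasDerivAt_id t).div_const μ)).congr_deriv ?_
    rw [truncExpQuantile]
    field_simp
    ring
  rw [intervalIntegral.integral_eq_sub_of_hasDerivAt hd (ContinuousOn.intervalIntegrable (by
    rw [Set.uIcc_of_le zero_le_one]; exact continuousOn_truncExpQuantile hμ))]
  simp
  field_simp
  ring

end TruncatedExponential

/-- The lower bound on the capacity achieved by the stacked truncated exponential input. -/
lemma le_misoCapacity_of_truncExp {n : ℕ} {h : Fin n → ℝ} (hh : ∀ k, 0 < h k) {v : ℝ≥0}
    (hv : 0 < v) {A : ℝ} (hA : 0 < A) {p : Fin n → ℝ} (hp : ∀ k, 0 < p k) (hs : ∑ k, p k = 1)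
    {μ : ℝ} (hμ : 0 < μ) {α : ℝ}
    (hα : 1 / μ - rexp (-μ) / (1 - rexp (-μ)) + ∑ k : Fin n, p k * (k.val : ℝ) ≤ α) :
    ((1 / 2 * log (1 + A ^ 2 * sCum h n ^ 2 / (2 * π * rexp 1 * v) * rexp (2 *
        (1 - log (μ / (1 - rexp (-μ))) - μ * rexp (-μ) / (1 - rexp (-μ))
          - ∑ k : Fin n, p k * log (p k * sCum h n / h k)))) : ℝ) : EReal)
      ≤ misoCapacity h v A (α * A) := by
  have h0 := truncExpQuantile_zero (μ := μ)
  have h1 := truncExpQuantile_one hμ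
  have hτm := monotoneOn_truncExpQuantile hμ
  have hτc := continuousOn_truncExpQuantile hμ
  have hτd : ∀ t ∈ Set.Ioo (0 : ℝ) 1, HasDerivAt (truncExpQuantile μ) _ t :=
    fun t ht => hasDerivAt_truncExpQuantile hμ ht.2.le
  have hc := one_sub_exp_neg_pos hμ
  have hX : Measurable (stackedInput p A (truncExpQuantile μ)) :=
    measurable_pi_iff.2 fun k => (monotone_stackedInput hp hA hτm k).measurable
  have hder {u : ℝ} {j : Fin n} (hu : u ∈ Set.Ioo (sCum p j.val) (sCum p (j.val + 1))) :=
    hasDerivAt_sum_stackedInput hp (A := A) h0 h1 hτd h hu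
  have hhp : ∀ k, 0 < A * h k / p k := fun k => div_pos (mul_pos hA (hh k)) (hp k)
  have hcover : ∀ u ∈ Set.Ioo (0 : ℝ) 1 \ Set.range (sCum p),
      ∃ j : Fin n, u ∈ Set.Ioo (sCum p j.val) (sCum p (j.val + 1)) := fun u hu =>
    exists_mem_Ioo_sCum hu.1.1 (fun k hk => hu.2 ⟨k, hk.symm⟩) le_rfl
      (by rw [sCum_self, hs]; exact hu.1.2)
  obtain ⟨hLi, hL⟩ := integral_Ioo_of_eqOn_Ioo_sCum hp hs
    (G := fun u => log (deriv (fun u => ∑ k, h k * stackedInput p A (truncExpQuantile μ) u k) u))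
    (g := fun k t => log (A * h k / p k) + (μ * truncExpQuantile μ t - log (μ / (1 - rexp (-μ)))))
    (fun k => by fun_prop)
    (fun k u hu => by
      have ht := (div_mem_Ioo_of_mem_Ioo_sCum hp hu).2.le
      rw [(hder hu).deriv, log_mul (hhp k).ne' (deriv_truncExpQuantile_pos hμ ht).ne',
        log_deriv_truncExpQuantile hμ ht])
  have key := le_mutualInfo_of_monotone_uniform hX (f := fun x => ∑ k, h k * x k)
    (by fun_prop)
    (fun u w huw => Finset.sum_le_sum fun k _ =>
      mul_le_mul_of_nonneg_left (monotone_stackedInput hp hA hτm k huw) (hh k).le)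
    (Set.countable_range (sCum p))
    (fun u hu => let ⟨j, hj⟩ := hcover u hu; (hder hj).differentiableAt)
    (fun u hu => by
      obtain ⟨j, hj⟩ := hcover u hu
      rw [(hder hj).deriv]
      exact mul_pos (hhp j)
        (deriv_truncExpQuantile_pos hμ (div_mem_Ioo_of_mem_Ioo_sCum hp hj).2.le))
    hLi hv
  have hn : 0 < sCum h n := by
    rw [sCum_self]
    refine Finset.sum_pos (fun k _ => hh k) (Finset.nonempty_of_ne_empty fun he => ?_)
    simp [he] at hs
  have hint : ∫ u in Set.Ioo (0 : ℝ) 1,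
      log (deriv (fun u => ∑ k, h k * stackedInput p A (truncExpQuantile μ) u k) u)
        = log (A * sCum h n) + (1 - log (μ / (1 - rexp (-μ))) - μ * rexp (-μ) / (1 - rexp (-μ))
          - ∑ k : Fin n, p k * log (p k * sCum h n / h k)) := by
    have hτi : IntervalIntegrable (truncExpQuantile μ) volume 0 1 :=
      ContinuousOn.intervalIntegrable (by rwa [Set.uIcc_of_le zero_le_one])
    have hk : ∀ k, ∫ t in (0 : ℝ)..1,
        (log (A * h k / p k) + (μ * truncExpQuantile μ t - log (μ / (1 - rexp (-μ)))))
        = (log (A * sCum h n) + (1 - log (μ / (1 - rexp (-μ))) - μ * rexp (-μ) / (1 - rexp (-μ))))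
          - log (p k * sCum h n / h k) := by
      intro k
      rw [intervalIntegral.integral_add (by simp) ((hτi.const_mul _).sub (by simp)),
        intervalIntegral.integral_sub (hτi.const_mul _) (by simp),
        intervalIntegral.integral_const_mul, integral_truncExpQuantile hμ,
        log_div (by have := hh k; positivity) (hp k).ne', log_mul hA.ne' (hh k).ne',
        log_mul hA.ne' hn.ne', log_div (by have := hp k; positivity) (hh k).ne',
        log_mul (hp k).ne' hn.ne']
      simp
      field_simp
      ring
    rw [hL]
    simp_rw [hk, mul_sub, Finset.sum_sub_distrib, ← Finset.sum_mul, hs]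
    ring
  refine le_trans ?_ (key.trans (le_iSup₂ (f := fun μ _ => mutualInfo (misoJoint h v μ))
    ((volume.restrict (Set.Ioo (0 : ℝ) 1)).map (stackedInput p A (truncExpQuantile μ))) ?_))
  · rw [hint, mul_add, exp_add, two_mul (log (A * sCum h n)), exp_add, exp_log (by positivity)]
    refine le_of_eq ?_
    congr 4
    ring
  · have : IsProbabilityMeasure (volume.restrict (Set.Ioo (0 : ℝ) 1)) := ⟨by simp⟩
    refine ⟨Measure.isProbabilityMeasure_map hX.aemeasurable, fun k => ?_, ?_⟩
    · rw [ae_map_iff hX.aemeasurable (measurableSet_Icc.preimage (measurable_pi_apply k))]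
      exact Eventually.of_forall fun u => stackedInput_mem_Icc hp hA h0 h1 hτm u k
    · have hk : ∀ k, ∫ x, x k ∂((volume.restrict (Set.Ioo (0 : ℝ) 1)).map
          (stackedInput p A (truncExpQuantile μ)))
          = A * (p k * (1 / μ - rexp (-μ) / (1 - rexp (-μ))) + (1 - sCum p (k.val + 1))) := by
        intro k
        rw [integral_map hX.aemeasurable (measurable_pi_apply k).aestronglyMeasurable,
          integral_stackedInput hp h0 h1 hτc hs, integral_truncExpQuantile hμ]
      simp_rw [hk]
      rw [← Finset.mul_sum, Finset.sum_add_distrib, ← Finset.sum_mul, hs,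
        sum_one_sub_sCum_succ hs, mul_comm, one_mul]
      exact mul_le_mul_of_nonneg_right hα hA.le

lemma half_lt_alphaTh {n : ℕ} (hn : 2 ≤ n) {h : Fin n → ℝ} (hh : ∀ k, 0 < h k) :
    1 / 2 < alphaTh h := by
  have h1 : 0 < ∑ k : Fin n, h k * (k.val : ℝ) :=
    Finset.sum_pos' (fun k _ => mul_nonneg (hh k).le k.val.cast_nonneg)
      ⟨⟨1, hn⟩, Finset.mem_univ _, by simpa using hh _⟩
  have h2 : 0 < sCum h n := by
    rw [sCum_self]
    exact Finset.sum_pos (fun k _ => hh k) ⟨⟨1, hn⟩, Finset.mem_univ _⟩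
  have := mul_pos (one_div_pos.2 h2) h1
  rw [alphaTh]
  linarith

/-- A supremum may be taken inside the logarithmic capacity bound. -/
lemma coe_log_one_add_mul_exp_sSup_le {C : EReal} {S : Set ℝ} (hS : S.Nonempty) {B : ℝ}
    (hB : 0 < B) (h : ∀ x ∈ S, ((1 / 2 * log (1 + B * rexp (2 * x)) : ℝ) : EReal) ≤ C) :
    ((1 / 2 * log (1 + B * rexp (2 * sSup S)) : ℝ) : EReal) ≤ C := by
  induction C with
  | bot => obtain ⟨x, hx⟩ := hS; exact absurd (le_bot_iff.1 (h x hx)) (EReal.coe_ne_bot _)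
  | top => exact le_top
  | coe c =>
    have hiff : ∀ x, 1 / 2 * log (1 + B * rexp (2 * x)) ≤ c
        ↔ B * rexp (2 * x) ≤ rexp (2 * c) - 1 := by
      intro x
      rw [le_sub_iff_add_le', ← log_le_iff_le_exp (by positivity)]
      constructor <;> intro h <;> linarith
    have hx : ∀ x ∈ S, B * rexp (2 * x) ≤ rexp (2 * c) - 1 := fun x hx =>
      (hiff x).1 (EReal.coe_le_coe_iff.1 (h x hx))
    obtain ⟨x₀, hx₀⟩ := hS
    have hc : 0 < rexp (2 * c) - 1 := (by positivity : 0 < B * rexp (2 * x₀)).trans_le (hx x₀ hx₀)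
    have hiff' : ∀ x, B * rexp (2 * x) ≤ rexp (2 * c) - 1
        ↔ x ≤ log ((rexp (2 * c) - 1) / B) / 2 := by
      intro x
      rw [le_div_iff₀ two_pos, mul_comm x, le_log_iff_exp_le (by positivity), le_div_iff₀' hB]
    exact EReal.coe_le_coe_iff.2 ((hiff _).2 ((hiff' _).2
      (csSup_le ⟨x₀, hx₀⟩ fun x hxS => (hiff' x).1 (hx x hxS))))

theorem miso_capacity_lower_bound_below_threshold (n : ℕ) (hn : 2 ≤ n) (h : Fin n → ℝ)
    (hord : ∀ i j : Fin n, i ≤ j → h j ≤ h i) (hpos : ∀ k, 0 < h k)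
    (v : ℝ≥0) (hv : 0 < v)
    (A α : ℝ) (hA : 0 < A) (hα0 : 0 < α) (hαn : α < (n : ℝ) / 2)
    (hαth : α < alphaTh h)
    (μf af : ℝ → ℝ)
    (hμf : ∀ l ∈ Set.Ioo (max 0 (1 / 2 + α - alphaTh h)) (min (1 / 2) α),
      0 < μf l ∧ 1 / μf l - Real.exp (-μf l) / (1 - Real.exp (-μf l)) = l)
    (haf : ∀ l ∈ Set.Ioo (max 0 (1 / 2 + α - alphaTh h)) (min (1 / 2) α),
      0 < af l ∧
        (∑ k : Fin n, h k * ((k.val : ℝ) + 1) * af l ^ (k.val + 1)) /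
            (∑ j : Fin n, h j * af l ^ (j.val + 1)) = α - l + 1)
    (p : ℝ → Fin n → ℝ)
    (hp : ∀ l k, p l k = h k * af l ^ (k.val + 1) /
      ∑ j : Fin n, h j * af l ^ (j.val + 1))
    (ν : ℝ)
    (hν : ν = sSup ((fun l =>
        1 - Real.log (μf l / (1 - Real.exp (-μf l)))
          - μf l * Real.exp (-μf l) / (1 - Real.exp (-μf l))
          - ∑ k : Fin n, p l k * Real.log (p l k * sCum h n / h k)) ''
      Set.Ioo (max 0 (1 / 2 + α - alphaTh h)) (min (1 / 2) α))) :
    ((1 / 2 * Real.log (1 + A ^ 2 * (sCum h n) ^ 2 / (2 * π * Real.exp 1 * (v : ℝ))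
        * Real.exp (2 * ν)) : ℝ) : EReal)
      ≤ misoCapacity h v A (α * A) := by
  have hth := half_lt_alphaTh hn hpos
  have hne : (Finset.univ : Finset (Fin n)).Nonempty := ⟨⟨1, hn⟩, Finset.mem_univ _⟩
  have hsn : 0 < sCum h n := by
    rw [sCum_self]
    exact Finset.sum_pos (fun k _ => hpos k) hne
  have hv' : (0 : ℝ) < v := hv
  rw [hν]
  refine coe_log_one_add_mul_exp_sSup_le ?_ (by positivity) ?_
  · refine (Set.nonempty_Ioo.2 (max_lt (lt_min (by norm_num) hα0) (lt_min ?_ ?_))).image _ <;>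
      linarith
  rintro _ ⟨l, hl, rfl⟩
  obtain ⟨hμ, hμl⟩ := hμf l hl
  obtain ⟨ha, hal⟩ := haf l hl
  have hw : ∀ k : Fin n, 0 < h k * af l ^ (k.val + 1) := fun k => mul_pos (hpos k) (pow_pos ha _)
  have hW := Finset.sum_pos (fun k _ => hw k) hne
  have hp0 : ∀ k, 0 < p l k := fun k => by rw [hp]; exact div_pos (hw k) hW
  have hs : ∑ k, p l k = 1 := by
    simp_rw [hp]
    rw [← Finset.sum_div, div_self hW.ne']
  refine le_misoCapacity_of_truncExp hpos hv hA hp0 hs hμ (le_of_eq ?_)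
  have hmean : ∑ k : Fin n, p l k * ((k.val : ℝ) + 1) = α - l + 1 := by
    rw [← hal, Finset.sum_div]
    refine Finset.sum_congr rfl fun k _ => ?_
    rw [hp]
    ring
  simp_rw [mul_add, mul_one, Finset.sum_add_distrib, hs] at hmean
  linarith
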